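/- arXiv:2505.02104 — 3 statements merged into one kernel-verified Lean document; each statement's English description precedes it below -/
import Mathlib

section
/- If two elements of the set M(0) = {(x, 0, z) ∈ ℤ³ : -6 ≤ x ≤ -3, 3 ≤ z ≤ 6, |z| ≤ |x|} lie in the same orbit of the group G generated by σ and τ, then they are equal; that is, the 10 elements of M(0) lie in pairwise distinct G-orbits. -/
/-- The "shift" `σ(x, y, z) = (y, z, x)`, a bijection of `ℤ³`. -/
def σ : Equiv.Perm (ℤ × ℤ × ℤ) where
  toFun p := (p.2.1, p.2.2, p.1)
  invFun p := (p.2.2, p.1, p.2.1)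
  left_inv _ := rfl
  right_inv _ := rfl

/-- The "involution" `τ(x, y, z) = (-z, -y, -x)`, a bijection of `ℤ³`. -/
def τ : Equiv.Perm (ℤ × ℤ × ℤ) where
  toFun p := (-p.2.2, -p.2.1, -p.1)
  invFun p := (-p.2.2, -p.2.1, -p.1)
  left_inv p := by simp
  right_inv p := by simp

/-- The subgroup of the group of bijections of `ℤ³` generated by `σ` and `τ`. -/
def G : Subgroup (Equiv.Perm (ℤ × ℤ × ℤ)) := Subgroup.closure {σ, τ}

/-- The `G`-orbit of a triple `p ∈ ℤ³`. -/
def orbitG (p : ℤ × ℤ × ℤ) : Set (ℤ × ℤ × ℤ) := {q | ∃ g ∈ G, g p = q}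

/-- The corrected parameter set `M(0) = {(x, 0, z) : -6 ≤ x ≤ -3, 3 ≤ z ≤ 6, |z| ≤ |x|}`. -/
def M0 : Set (ℤ × ℤ × ℤ) :=
  {p | p.2.1 = 0 ∧ -6 ≤ p.1 ∧ p.1 ≤ -3 ∧ 3 ≤ p.2.2 ∧ p.2.2 ≤ 6 ∧ |p.2.2| ≤ |p.1|}

theorem apply_eq_of_mem_G {α : Type*} {f : ℤ × ℤ × ℤ → α} (hσ : ∀ p, f (σ p) = f p)
    (hτ : ∀ p, f (τ p) = f p) {g : Equiv.Perm (ℤ × ℤ × ℤ)} (hg : g ∈ G) (p : ℤ × ℤ × ℤ) :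
    f (g p) = f p := by
  induction hg using Subgroup.closure_induction generalizing p with
  | mem g hg =>
    rcases hg with rfl | rfl
    · exact hσ p
    · exact hτ p
  | one => rfl
  | mul g h _ _ hg hh => exact (hg (h p)).trans (hh p)
  | inv g _ hg => simpa using (hg (g⁻¹ p)).symm

theorem sq_sum_apply_of_mem_G {g : Equiv.Perm (ℤ × ℤ × ℤ)} (hg : g ∈ G) (p : ℤ × ℤ × ℤ) :
    ((g p).1 + (g p).2.1 + (g p).2.2) ^ 2 = (p.1 + p.2.1 + p.2.2) ^ 2 :=
  apply_eq_of_mem_G (f := fun p => (p.1 + p.2.1 + p.2.2) ^ 2)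
    (fun p => by simp only [σ, Equiv.coe_fn_mk]; ring)
    (fun p => by simp only [τ, Equiv.coe_fn_mk]; ring) hg p

theorem sum_mul_apply_of_mem_G {g : Equiv.Perm (ℤ × ℤ × ℤ)} (hg : g ∈ G) (p : ℤ × ℤ × ℤ) :
    (g p).1 * (g p).2.1 + (g p).2.1 * (g p).2.2 + (g p).2.2 * (g p).1 =
      p.1 * p.2.1 + p.2.1 * p.2.2 + p.2.2 * p.1 :=
  apply_eq_of_mem_G (f := fun p => p.1 * p.2.1 + p.2.1 * p.2.2 + p.2.2 * p.1)
    (fun p => by simp only [σ, Equiv.coe_fn_mk]; ring)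
    (fun p => by simp only [τ, Equiv.coe_fn_mk]; ring) hg p

theorem M0_pairwise_inequivalent :
    ∀ p ∈ M0, ∀ q ∈ M0, q ∈ orbitG p → p = q := by
  rintro ⟨x, y, z⟩ ⟨hy, -, hx, hz, -, hxz⟩ q hq ⟨g, hg, rfl⟩
  have hsq := sq_sum_apply_of_mem_G hg (x, y, z)
  have hmul := sum_mul_apply_of_mem_G hg (x, y, z)
  generalize g (x, y, z) = q at *
  obtain ⟨x', y', z'⟩ := q
  obtain ⟨hy', -, hx', hz', -, hxz'⟩ := hq
  dsimp only at *
  subst hy hy'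
  rw [abs_of_nonneg (by lia), abs_of_nonpos (by lia)] at hxz hxz'
  have hsum : -(x' + z') = -(x + z) :=
    (sq_eq_sq₀ (by lia) (by lia)).mp (by linear_combination hsq)
  have hdiff : z' - x' = z - x :=
    (sq_eq_sq₀ (by lia) (by lia)).mp (by linear_combination hsq - 4 * hmul)
  ext <;> dsimp only <;> lia
end

section
/- Let U ⊆ ℤ³ be the union of the nine sets K = {(x,-3,3) : 3 ≤ x ≤ 9}, M(0) = {(x,0,z) : -6 ≤ x ≤ -3, 3 ≤ z ≤ 6, |z| ≤ |x|}, M(-1) = {(x,-1,z) : -7 ≤ x ≤ -3, 3 ≤ z ≤ 5}, M(-2) = {(x,-2,z) : -8 ≤ x ≤ -3, 3 ≤ z ≤ 4}, and N(k) = {(x,y,k) : -3-f(k) ≤ y ≤ -3, y-6 ≤ x ≤ -3} for k = -2,-1,0,1,2 where f(-2)=5, f(-1)=4, f(0)=3, f(1)=2, f(2)=1. Then any two distinct elements of U lie in distinct orbits of the group G generated by σ and τ. -/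
def K : Set (ℤ × ℤ × ℤ) :=
  {p | p.2.1 = -3 ∧ p.2.2 = 3 ∧ 3 ≤ p.1 ∧ p.1 ≤ 9}

def Mm1 : Set (ℤ × ℤ × ℤ) :=
  {p | p.2.1 = -1 ∧ -7 ≤ p.1 ∧ p.1 ≤ -3 ∧ 3 ≤ p.2.2 ∧ p.2.2 ≤ 5}

def Mm2 : Set (ℤ × ℤ × ℤ) :=
  {p | p.2.1 = -2 ∧ -8 ≤ p.1 ∧ p.1 ≤ -3 ∧ 3 ≤ p.2.2 ∧ p.2.2 ≤ 4}

/-- `f(-2) = 5`, `f(-1) = 4`, `f(0) = 3`, `f(1) = 2`, `f(2) = 1`. -/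
def f : ℤ → ℤ := fun k => 3 - k

/-- `N(k) = {(x, y, k) : -3 - f(k) ≤ y ≤ -3, y - 6 ≤ x ≤ -3}`. -/
def N (k : ℤ) : Set (ℤ × ℤ × ℤ) :=
  {p | p.2.2 = k ∧ -3 - f k ≤ p.2.1 ∧ p.2.1 ≤ -3 ∧ p.2.1 - 6 ≤ p.1 ∧ p.1 ≤ -3}

/-- The union of the nine corrected parameter sets. -/
def U : Set (ℤ × ℤ × ℤ) :=
  K ∪ M0 ∪ Mm1 ∪ Mm2 ∪ N (-2) ∪ N (-1) ∪ N 0 ∪ N 1 ∪ N 2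

/-- Every element of `G` acts as a power of the shift, possibly composed with the involution. -/
theorem apply_cases_of_mem_G {g : Equiv.Perm (ℤ × ℤ × ℤ)} (hg : g ∈ G) :
    ∀ x y z : ℤ, g (x, y, z) = (x, y, z) ∨ g (x, y, z) = (y, z, x) ∨ g (x, y, z) = (z, x, y) ∨
      g (x, y, z) = (-z, -y, -x) ∨ g (x, y, z) = (-y, -x, -z) ∨ g (x, y, z) = (-x, -z, -y) := by
  induction hg using Subgroup.closure_induction_left with
  | one => simp
  | mul_left a ha b hb ih =>
    intro x y z
    rcases ha with rfl | rfl <;> rcases ih x y z with h | h | h | h | h | h <;>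
      simp [σ, τ, h]
  | inv_mul_cancel a ha b hb ih =>
    intro x y z
    rcases ha with rfl | rfl <;> rcases ih x y z with h | h | h | h | h | h <;>
      simp [σ, τ, h, Equiv.Perm.inv_def, Equiv.symm]

/-- The sign and size constraints on the elements of `U` that separate the orbits. -/
theorem constraints_of_mem_U {x y z : ℤ} (h : (x, y, z) ∈ U) :
    (3 ≤ x ∧ y = -3 ∧ z = 3) ∨ (x ≤ -3 ∧ y = 0 ∧ 3 ≤ z ∧ z ≤ -x) ∨
      (x ≤ -3 ∧ -2 ≤ y ∧ y ≤ -1 ∧ 3 ≤ z) ∨ (x ≤ -3 ∧ y ≤ -3 ∧ -2 ≤ z ∧ z ≤ 2) := by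
  simp only [U, K, M0, Mm1, Mm2, N, f, Set.mem_union, Set.mem_ofPred_eq, abs_le, le_abs] at h
  omega

theorem U_pairwise_inequivalent :
    ∀ p ∈ U, ∀ q ∈ U, p ≠ q → q ∉ orbitG p := by
  rintro ⟨x, y, z⟩ hp ⟨x', y', z'⟩ hq hne ⟨g, hg, hgp⟩
  have hp' := constraints_of_mem_U hp
  have hq' := constraints_of_mem_U hq
  have hg' := apply_cases_of_mem_G hg x y z
  simp only [hgp, Prod.mk.injEq] at hg'
  simp only [ne_eq, Prod.mk.injEq] at hne
  omega
end

section
/- Let L ⊆ ℤ³ be the set consisting of the twelve triples (0,1,-1), (0,1,2), (0,1,-2), (0,2,1), (0,2,-2), (0,-1,2), (0,-1,1), (0,-2,2), (1,2,-1), (1,2,-2), (1,-1,2), (1,-2,2), together with the triples (x,y,y) for x ∈ {1,2} and y ∈ {-2,-1,0,1,2} with y ≠ x, the triples (0,1,1) and (0,2,2), and the triples (x,x,x) for x ∈ {0,1,2}. Then L has exactly 25 elements, and any two distinct elements of L lie in distinct orbits of the group G generated by σ and τ. -/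
/-- The corrected list of representatives: the twelve listed triples, the triples `(x, y, y)`
for `x ∈ {1, 2}`, `y ∈ {-2, -1, 0, 1, 2} \ {x}`, the triples `(0, 1, 1)` and `(0, 2, 2)`,
and the triples `(x, x, x)` for `x ∈ {0, 1, 2}`. -/
def L : Set (ℤ × ℤ × ℤ) :=
  {(0, 1, -1), (0, 1, 2), (0, 1, -2), (0, 2, 1), (0, 2, -2), (0, -1, 2),
   (0, -1, 1), (0, -2, 2), (1, 2, -1), (1, 2, -2), (1, -1, 2), (1, -2, 2)} ∪
  {p | ∃ x ∈ ({1, 2} : Set ℤ), ∃ y ∈ ({-2, -1, 0, 1, 2} : Set ℤ), y ≠ x ∧ p = (x, y, y)} ∪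
  {(0, 1, 1), (0, 2, 2)} ∪
  {p | ∃ x ∈ ({0, 1, 2} : Set ℤ), p = (x, x, x)}

/-- The explicit orbit of a triple: its cyclic shifts and those of its image under `τ`. -/
def orbitFinset (p : ℤ × ℤ × ℤ) : Finset (ℤ × ℤ × ℤ) :=
  {(p.1, p.2.1, p.2.2), (p.2.1, p.2.2, p.1), (p.2.2, p.1, p.2.1),
   (-p.2.2, -p.2.1, -p.1), (-p.2.1, -p.1, -p.2.2), (-p.1, -p.2.2, -p.2.1)}

/-- The set `L` as a finset. -/
def LFinset : Finset (ℤ × ℤ × ℤ) :=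
  {(0, 1, 1), (0, 2, 2),
   (0, 1, -1), (0, 1, 2), (0, 1, -2), (0, 2, 1), (0, 2, -2), (0, -1, 2),
   (0, -1, 1), (0, -2, 2), (1, 2, -1), (1, 2, -2), (1, -1, 2), (1, -2, 2),
   (1, -2, -2), (1, -1, -1), (1, 0, 0), (1, 2, 2),
   (2, -2, -2), (2, -1, -1), (2, 0, 0), (2, 1, 1),
   (0, 0, 0), (1, 1, 1), (2, 2, 2)}

theorem σ_mem_orbitFinset {p q : ℤ × ℤ × ℤ} (h : q ∈ orbitFinset p) : σ q ∈ orbitFinset p := by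
  simp only [orbitFinset, Finset.mem_insert, Finset.mem_singleton] at h ⊢
  rcases h with rfl | rfl | rfl | rfl | rfl | rfl <;> simp [σ]

theorem τ_mem_orbitFinset {p q : ℤ × ℤ × ℤ} (h : q ∈ orbitFinset p) : τ q ∈ orbitFinset p := by
  simp only [orbitFinset, Finset.mem_insert, Finset.mem_singleton] at h ⊢
  rcases h with rfl | rfl | rfl | rfl | rfl | rfl <;> simp [τ]

theorem σ_inv_apply (q : ℤ × ℤ × ℤ) : σ⁻¹ q = σ (σ q) := rfl

theorem τ_inv_apply (q : ℤ × ℤ × ℤ) : τ⁻¹ q = τ q := rfl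

theorem orbitG_subset_orbitFinset (p : ℤ × ℤ × ℤ) : orbitG p ⊆ orbitFinset p := by
  rintro _ ⟨g, hg, rfl⟩
  rw [Finset.mem_coe]
  induction hg using Subgroup.closure_induction_left with
  | one => simp [orbitFinset]
  | mul_left x hx y _ ih =>
    rcases hx with rfl | rfl
    · exact σ_mem_orbitFinset ih
    · exact τ_mem_orbitFinset ih
  | inv_mul_cancel x hx y _ ih =>
    rcases hx with rfl | rfl
    · rw [Equiv.Perm.mul_apply, σ_inv_apply]
      exact σ_mem_orbitFinset (σ_mem_orbitFinset ih)
    · rw [Equiv.Perm.mul_apply, τ_inv_apply]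
      exact τ_mem_orbitFinset ih

theorem L_eq_coe_LFinset : L = LFinset := by
  ext ⟨a, b, c⟩
  simp [L, LFinset, -Prod.mk.injEq, -Prod.mk_eq_zero, -Prod.mk_eq_one, or_assoc]

theorem notMem_orbitFinset_of_mem_LFinset :
    ∀ p ∈ LFinset, ∀ q ∈ LFinset, p ≠ q → q ∉ orbitFinset p := by
  decide +kernel

theorem L_card_and_pairwise_inequivalent :
    L.ncard = 25 ∧ ∀ p ∈ L, ∀ q ∈ L, p ≠ q → q ∉ orbitG p := by
  rw [L_eq_coe_LFinset]
  refine ⟨?_, fun p hp q hq hpq h ↦ ?_⟩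
  · rw [Set.ncard_coe_finset]
    decide +kernel
  · exact notMem_orbitFinset_of_mem_LFinset p hp q hq hpq (orbitG_subset_orbitFinset p h)
end
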